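/- arXiv:1508.01189 — 5 statements merged into one kernel-verified Lean document; each statement's English description precedes it below -/
import Mathlib

section
/- For every integer N ≥ 1, ∏_{j=0}^{N−1} (3 − 2·cos(2πj/N)) = U_{N−1}(√5/2)², where U_{N−1} is the Chebyshev polynomial of the second kind of degree N−1. -/
open Matrix Real Filter

lemma stmt4_U (s a b : ℝ) (hs : a + b = 2 * s) (hab : a * b = 1) (hd : a - b = 1) (n : ℕ) :
    (Polynomial.Chebyshev.U ℝ (n : ℤ)).eval s = a ^ (n + 1) - b ^ (n + 1) := by
  induction n using Nat.twoStepInduction with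
  | zero => simp [hd]
  | one => simp; linear_combination (-(a - b)) * hs - 2 * s * hd
  | more n h0 h1 =>
    push_cast at h0 h1 ⊢
    rw [Polynomial.Chebyshev.U_add_two]
    simp only [Polynomial.eval_sub, Polynomial.eval_mul, Polynomial.eval_X, Polynomial.eval_ofNat]
    rw [h0, h1, ← hs]
    linear_combination (a ^ (n + 1) - b ^ (n + 1)) * hab

lemma stmt4_prod (ζ a b : ℂ) (N : ℕ) (hN : 0 < N) (hζ : IsPrimitiveRoot ζ N) :
    a ^ N - b ^ N = ∏ j : Fin N, (a - ζ ^ (j : ℕ) * b) := by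
  have h := congrArg (Polynomial.eval a) (X_pow_sub_C_eq_prod hζ hN (rfl : b ^ N = b ^ N))
  rw [Fin.prod_univ_eq_prod_range (fun j => a - ζ ^ j * b)]
  simpa [Polynomial.eval_prod] using h

theorem stmt4 (N : ℕ) (hN : 1 ≤ N) :
    ∏ j : Fin N, (3 - 2 * Real.cos (2 * Real.pi * j / N)) =
      ((Polynomial.Chebyshev.U ℝ ((N : ℤ) - 1)).eval (Real.sqrt 5 / 2)) ^ 2 := by
  have h5 : Real.sqrt 5 ^ 2 = 5 := Real.sq_sqrt (by norm_num)
  obtain ⟨a, ha⟩ : ∃ a, a = (Real.sqrt 5 + 1) / 2 := ⟨_, rfl⟩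
  obtain ⟨b, hb⟩ : ∃ b, b = (Real.sqrt 5 - 1) / 2 := ⟨_, rfl⟩
  have hab : a * b = 1 := by rw [ha, hb]; linear_combination h5 / 4
  have hd : a - b = 1 := by rw [ha, hb]; ring
  have hU := stmt4_U (Real.sqrt 5 / 2) a b (by rw [ha, hb]; ring) hab hd (N - 1)
  rw [Nat.sub_add_cancel hN, Nat.cast_sub hN, Nat.cast_one] at hU
  rw [hU]
  have hz := Complex.isPrimitiveRoot_exp N (by omega)
  have h1 := stmt4_prod _ a b N hN hz
  have h2 := stmt4_prod _ a b N hN hz.inv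
  have habC : (a : ℂ) * b = 1 := by exact_mod_cast hab
  have hdC : (a : ℂ) - b = 1 := by exact_mod_cast hd
  apply Complex.ofReal_injective
  push_cast
  rw [sq]
  nth_rewrite 1 [h1]
  rw [h2, ← Finset.prod_mul_distrib]
  refine Finset.prod_congr rfl fun j _ => ?_
  rw [← Complex.exp_neg, ← Complex.exp_nat_mul, ← Complex.exp_nat_mul, Complex.two_cos]
  have e1 : (j : ℂ) * (2 * Real.pi * Complex.I / N) = 2 * Real.pi * j / N * Complex.I := by ring
  have e2 : (j : ℂ) * -(2 * Real.pi * Complex.I / N) = -(2 * Real.pi * j / N) * Complex.I := by ring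
  rw [e1, e2]
  have e3 : Complex.exp (2 * Real.pi * j / N * Complex.I) * Complex.exp (-(2 * Real.pi * j / N) * Complex.I) = 1 := by
    rw [← Complex.exp_add]; simp
  generalize Complex.exp (2 * Real.pi * j / N * Complex.I) = z at *
  generalize Complex.exp (-(2 * Real.pi * j / N) * Complex.I) = w at *
  linear_combination (-(a - b : ℂ) - 1) * hdC + (z + w - 2) * habC - b ^ 2 * e3
end

section
/- For every integer N ≥ 3, det C_N = ((3 + √5)/2)^N + ((3 − √5)/2)^N − 2. -/
open Matrix Real Filter

def Cmat (N : ℕ) : Matrix (Fin N) (Fin N) ℝ :=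
  Matrix.of fun i j =>
    if i = j then 3
    else if ((i : ℕ) : ZMod N) - ((j : ℕ) : ZMod N) = 1 ∨
        ((i : ℕ) : ZMod N) - ((j : ℕ) : ZMod N) = -1 then -1
    else 0

def Bmat (n : ℕ) (b : ℝ) : Matrix (Fin (n+1)) (Fin (n+1)) ℝ :=
  Matrix.of fun i j => (if i = j then 1 else 0) - b * (if j = i + 1 then 1 else 0)

lemma Bmat_det (n : ℕ) (hn : 1 ≤ n) (b : ℝ) : (Bmat n b).det = 1 - b ^ (n+1) := by
  have key : ∀ i j : Fin (n+1), (j = i + 1) ↔ ((j:ℕ) = i + 1 ∨ ((j:ℕ) = 0 ∧ (i:ℕ) = n)) := by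
    intro i j
    rw [Fin.ext_iff, Fin.val_add_one]
    have := i.2
    have := j.2
    split_ifs with h
    · rw [Fin.ext_iff, Fin.val_last] at h
      omega
    · rw [Fin.ext_iff, Fin.val_last] at h
      omega
  have h0 : ((Bmat n b).submatrix (Fin.succAbove 0) Fin.succ).det = 1 := by
    rw [Matrix.det_of_isUpperTriangular]
    · apply Finset.prod_eq_one
      intro i _
      simp only [Bmat, submatrix_apply, of_apply, key, Fin.ext_iff, Fin.succAbove_zero, Fin.val_succ]
      simp
    · intro i j hij
      simp only [id] at hij
      have : (j:ℕ) < i := hij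
      simp only [Bmat, submatrix_apply, of_apply, key, Fin.ext_iff, Fin.succAbove_zero, Fin.val_succ]
      rw [if_neg (by omega), if_neg (by omega)]
      simp
  have h1 : ((Bmat n b).submatrix (Fin.succAbove (Fin.last n)) Fin.succ).det = (-b)^n := by
    rw [Matrix.det_of_isLowerTriangular]
    · rw [Finset.prod_congr rfl (g := fun _ => -b)]
      · simp
      intro i _
      simp only [Bmat, submatrix_apply, of_apply, key, Fin.ext_iff, Fin.succAbove_last, Fin.val_succ, Fin.val_castSucc]
      simp
    · intro i j hij
      have : (i:ℕ) < j := hij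
      simp only [Bmat, submatrix_apply, of_apply, key, Fin.ext_iff, Fin.succAbove_last, Fin.val_succ, Fin.val_castSucc]
      rw [if_neg (by omega), if_neg (by omega)]
      simp
  have hne : (0 : Fin (n+1)) ≠ Fin.last n := by
    rw [Ne, Fin.ext_iff]; simp; omega
  rw [Matrix.det_succ_column_zero, Fintype.sum_eq_add 0 (Fin.last n) hne, h0, h1]
  · simp only [Bmat, of_apply, key, Fin.ext_iff, Fin.val_last, Fin.val_zero]
    have hn0 : n ≠ 0 := by omega
    simp [hn0, hn0.symm]
    have : (-1:ℝ)^n * (-b)^n = b^n := by rw [← mul_pow]; simp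
    linear_combination (-b) * this
  · rintro i ⟨hi0, hil⟩
    rw [Ne, Fin.ext_iff] at hi0 hil
    rw [Fin.val_last] at hil
    rw [Fin.val_zero] at hi0
    have : Bmat n b i 0 = 0 := by
      simp only [Bmat, of_apply, key, Fin.ext_iff]
      simp [hi0, hil]
    rw [this]; simp

lemma Cmat_eq (n : ℕ) (hn : 2 ≤ n) (a b : ℝ) (hab : a * b = 1) (hs : a + b = 3) :
    Cmat (n+1) = a • (Bmat n b * (Bmat n b)ᵀ) := by
  have h2 : (1 : Fin (n+1)) + 1 ≠ 0 := by
    rw [Ne, Fin.ext_iff, Fin.val_add, Fin.val_one', Fin.val_zero,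
      Nat.mod_eq_of_lt (show 1 < n + 1 by omega), Nat.mod_eq_of_lt (by omega)]
    omega
  have h1 : (1 : Fin (n+1)) ≠ 0 := by
    rw [Ne, Fin.ext_iff, Fin.val_one', Fin.val_zero, Nat.mod_eq_of_lt (by omega)]
    omega
  ext i j
  have hk : ∀ k : Fin (n+1), ((k : ℕ) : ZMod (n+1)) = (k : Fin (n+1)) :=
    fun k => Fin.cast_val_eq_self k
  have e1 : (((i : ℕ) : ZMod (n+1)) - ((j : ℕ) : ZMod (n+1)) = 1) ↔ i = j + 1 := by
    rw [hk i, hk j]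
    have : (i - j = 1) ↔ i = j + 1 := by rw [sub_eq_iff_eq_add']
    exact this
  have e2 : (((i : ℕ) : ZMod (n+1)) - ((j : ℕ) : ZMod (n+1)) = -1) ↔ j = i + 1 := by
    rw [hk i, hk j]
    have : (i - j = -1) ↔ j = i + 1 := by
      rw [← neg_inj, neg_sub, neg_neg, sub_eq_iff_eq_add']
    exact this
  have hp : (Bmat n b * (Bmat n b)ᵀ) i j = (if i = j then 1 else 0)
      - b * (if i = j + 1 then 1 else 0) - b * (if j = i + 1 then 1 else 0)
      + b * b * (if i = j then 1 else 0) := by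
    simp only [Bmat, mul_apply, transpose_apply, of_apply, sub_mul, mul_sub, Finset.sum_sub_distrib]
    simp only [mul_ite, ite_mul, mul_one, mul_zero, one_mul, zero_mul, Finset.sum_ite_eq,
      Finset.sum_ite_eq', Finset.mem_univ, if_true, add_left_inj, eq_comm (a := j) (b := i)]
    ring
  rw [Matrix.smul_apply, hp, Cmat, of_apply]
  simp only [e1, e2, smul_eq_mul]
  by_cases hij : i = j
  · subst hij
    have : ¬ (i = i + 1) := by simpa using h1
    simp only [this, if_true, if_false]
    linear_combination -hs - b * hab
  · by_cases ha : i = j + 1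
    · have : ¬ (j = i + 1) := by
        intro h
        rw [ha, add_assoc] at h
        exact h2 (by simpa using h)
      rw [if_neg hij, if_pos (Or.inl ha), if_neg hij, if_pos ha, if_neg this]
      linear_combination hab
    · by_cases hb : j = i + 1
      · rw [if_neg hij, if_pos (Or.inr hb), if_neg hij, if_neg ha, if_pos hb]
        linear_combination hab
      · simp [hij, ha, hb]

theorem stmt6 (N : ℕ) (hN : 3 ≤ N) :
    (Cmat N).det =
      ((3 + Real.sqrt 5) / 2) ^ N + ((3 - Real.sqrt 5) / 2) ^ N - 2 := by
  obtain ⟨n, rfl⟩ : ∃ n, N = n + 1 := ⟨N - 1, by omega⟩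
  have h5 : Real.sqrt 5 * Real.sqrt 5 = 5 := Real.mul_self_sqrt (by norm_num)
  generalize ha : (3 + Real.sqrt 5) / 2 = a
  generalize hb : (3 - Real.sqrt 5) / 2 = b
  have hab : a * b = 1 := by
    rw [← ha, ← hb]; linear_combination (-1/4) * h5
  have hs : a + b = 3 := by rw [← ha, ← hb]; ring
  rw [Cmat_eq n (by omega) a b hab hs, det_smul, det_mul, det_transpose,
    Bmat_det n (by omega), Fintype.card_fin]
  have hp : a ^ (n+1) * b ^ (n+1) = 1 := by rw [← mul_pow, hab, one_pow]
  linear_combination (-2 + b ^ (n+1)) * hp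
end

section
/- For every integer N ≥ 3, det(L_N with row 1 and column 1 removed) = det C_N; that is, deleting from the Laplacian L_N the row and column indexed by the outer-ring state (1,0) yields a matrix whose determinant equals det C_N. -/
open Matrix Real Filter

def Amat (N : ℕ) : Matrix (Fin N) (Fin N) ℝ :=
  Matrix.of fun i j =>
    if i = j then 1
    else if (i : ℕ) = (j : ℕ) + 1 ∧ (i : ℕ) + 1 < N then -1
    else if (i : ℕ) = N - 1 ∧ (j : ℕ) = 0 then -1
    else 0

def Bblk (N : ℕ) : Matrix (Fin N) (Fin N) ℝ :=
  Matrix.of fun i j => if (i : ℕ) = 0 ∧ (j : ℕ) = 0 then -1 else 0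

def Lmat (N : ℕ) : Matrix (Fin (N + N)) (Fin (N + N)) ℝ :=
  (Matrix.fromBlocks (Amat N) (Bblk N) (-1) (Cmat N)).submatrix
    finSumFinEquiv.symm finSumFinEquiv.symm

def dropIdx {n : ℕ} (i : Fin n) (k : Fin (n - 1)) : Fin n :=
  ⟨if (k : ℕ) < (i : ℕ) then (k : ℕ) else (k : ℕ) + 1, by
    have hk := k.isLt; have hi := i.isLt; split <;> omega⟩

def minor {n : ℕ} (M : Matrix (Fin n) (Fin n) ℝ) (i j : Fin n) :
    Matrix (Fin (n - 1)) (Fin (n - 1)) ℝ :=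
  M.submatrix (dropIdx i) (dropIdx j)

theorem stmt8 (N : ℕ) (hN : 3 ≤ N) :
    (minor (Lmat N) ⟨0, by omega⟩ ⟨0, by omega⟩).det = (Cmat N).det := by
  obtain ⟨n, rfl⟩ : ∃ n, N = n + 1 := ⟨N - 1, by omega⟩
  have hc : n + (n + 1) = (n + 1) + (n + 1) - 1 := by omega
  let e : Fin n ⊕ Fin (n + 1) ≃ Fin ((n + 1) + (n + 1) - 1) :=
    finSumFinEquiv.trans (finCongr hc)
  rw [← Matrix.det_submatrix_equiv_self e]
  have hl : ∀ i : Fin n, finSumFinEquiv.symm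
      (dropIdx (n := (n + 1) + (n + 1)) ⟨0, by omega⟩ (e (Sum.inl i)))
      = Sum.inl i.succ := by
    intro i
    rw [Equiv.symm_apply_eq]
    ext
    simp [dropIdx, e]
  have hr : ∀ i : Fin (n + 1), finSumFinEquiv.symm
      (dropIdx (n := (n + 1) + (n + 1)) ⟨0, by omega⟩ (e (Sum.inr i)))
      = Sum.inr i := by
    intro i
    rw [Equiv.symm_apply_eq]
    ext
    simp [dropIdx, e]
    omega
  have key : (minor (Lmat (n + 1)) ⟨0, by omega⟩ ⟨0, by omega⟩).submatrix e e
      = Matrix.fromBlocks ((Amat (n + 1)).submatrix Fin.succ Fin.succ) 0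
        ((-1 : Matrix (Fin (n + 1)) (Fin (n + 1)) ℝ).submatrix id Fin.succ)
        (Cmat (n + 1)) := by
    ext i j
    rcases i with i | i <;> rcases j with j | j <;>
      simp only [minor, Lmat, Matrix.submatrix_apply, hl, hr, Matrix.fromBlocks_apply₁₁,
        Matrix.fromBlocks_apply₁₂, Matrix.fromBlocks_apply₂₁, Matrix.fromBlocks_apply₂₂, id]
    simp [Bblk]
  have hA : ((Amat (n + 1)).submatrix Fin.succ Fin.succ).det = 1 := by
    rw [Matrix.det_of_lowerTriangular]
    · simp [Amat]
    · intro i j hij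
      have hij' : (i : ℕ) < (j : ℕ) := hij
      have h1 : i ≠ j := by rintro rfl; omega
      simp [Amat, h1]
      omega
  rw [key, Matrix.det_fromBlocks_zero₁₂, hA, one_mul]
end

section
/- For every integer N ≥ 3 and every i with 1 ≤ i ≤ N, det(L_N with row N+i and column N+i removed) = (−1)^{i+1} · det(C_N with row i and column 1 removed); that is, the principal cofactor of the Laplacian L_N at the inner-ring state (i,1) equals the signed (i,1)-minor of C_N. -/
open Matrix Real Filter

theorem dropIdx_eq {n : ℕ} (i : Fin (n + 1)) :
    (dropIdx i : Fin n → Fin (n + 1)) = i.succAbove := by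
  funext k
  apply Fin.ext
  simp only [dropIdx, Fin.succAbove, Fin.lt_def, Fin.val_castSucc]
  split <;> simp

theorem minor_eq {n : ℕ} (M : Matrix (Fin (n + 1)) (Fin (n + 1)) ℝ) (i j : Fin (n + 1)) :
    (minor M i j).det = (-1) ^ (i + j : ℕ) * M.adjugate j i := by
  have h : (minor M i j).det = (M.submatrix i.succAbove j.succAbove).det := by
    rw [← dropIdx_eq, ← dropIdx_eq]; rfl
  rw [h, adjugate_fin_succ_eq_det_submatrix, ← mul_assoc, ← pow_add,
    Even.neg_one_pow ⟨_, rfl⟩, one_mul]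

theorem Cmat_rowsum (n : ℕ) (hn : 2 ≤ n) (i : Fin (n + 1)) :
    ∑ j, Cmat (n + 1) i j = 1 := by
  have key : ∀ i j : ZMod (n + 1), (if i = j then (3 : ℝ)
      else if i - j = 1 ∨ i - j = -1 then -1 else 0)
      = (if j = i then 3 else 0) + (if j = i - 1 then -1 else 0)
        + (if j = i + 1 then -1 else 0) := by
    intro i j
    have h1 : (1 : ZMod (n + 1)) ≠ 0 := by
      have := (ZMod.natCast_eq_zero_iff 1 (n + 1)).not.mpr
        (fun h => by have := Nat.le_of_dvd (by norm_num) h; omega)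
      simpa using this
    have h2 : (2 : ZMod (n + 1)) ≠ 0 := by
      have := (ZMod.natCast_eq_zero_iff 2 (n + 1)).not.mpr
        (fun h => by have := Nat.le_of_dvd (by norm_num) h; omega)
      simpa using this
    have e1 : i - j = 1 ↔ j = i - 1 := by
      constructor <;> intro h <;> linear_combination -h
    have e2 : i - j = -1 ↔ j = i + 1 := by
      constructor <;> intro h <;> linear_combination -h
    simp only [e1, e2]
    by_cases a : j = i
    · subst a
      have : ¬ (j = j - 1) := fun h => h1 (by linear_combination h)
      have : ¬ (j = j + 1) := fun h => h1 (by linear_combination -h)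
      simp [*]
    · have a' : ¬ i = j := fun h => a h.symm
      by_cases b : j = i - 1
      · have : ¬ (j = i + 1) := fun h => h2 (by linear_combination b - h)
        simp only [a, a', this, if_false, if_pos b, or_false]
        norm_num
      · simp [a, a', b]
  let f : Fin (n + 1) → ZMod (n + 1) := fun k => ((k : ℕ) : ZMod (n + 1))
  have hinj : Function.Injective f := by
    intro a b h
    have h' := (ZMod.natCast_eq_natCast_iff' _ _ _).mp h
    rw [Nat.mod_eq_of_lt a.isLt, Nat.mod_eq_of_lt b.isLt] at h'
    exact Fin.ext h'
  have hbij : Function.Bijective f :=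
    (Fintype.bijective_iff_injective_and_card f).mpr ⟨hinj, by simp [ZMod.card]⟩
  have h : ∀ j : Fin (n + 1), Cmat (n + 1) i j =
      (fun z : ZMod (n + 1) => (if z = f i then (3 : ℝ) else 0)
      + (if z = f i - 1 then -1 else 0) + (if z = f i + 1 then -1 else 0)) (f j) := by
    intro j
    simp only []
    rw [← key]
    simp only [Cmat, Matrix.of_apply, hinj.eq_iff]
    rfl
  rw [Finset.sum_congr rfl (fun j _ => h j), hbij.sum_comp (fun z : ZMod (n + 1) =>
      (if z = f i then (3 : ℝ) else 0)
      + (if z = f i - 1 then -1 else 0) + (if z = f i + 1 then -1 else 0)), Finset.sum_add_distrib,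
    Finset.sum_add_distrib]
  simp only [Finset.sum_ite_eq', Finset.mem_univ, if_true]
  norm_num

theorem Amat_det (n : ℕ) : (Amat (n + 1)).det = 1 := by
  rw [det_of_isLowerTriangular]
  · simp [Amat]
  · intro i j hij
    have hij : i < j := hij
    have h : (i : ℕ) < j := hij
    simp only [Amat, of_apply]
    rw [if_neg hij.ne, if_neg (by omega), if_neg (by omega)]

theorem AX_add_B (n : ℕ) (hn : 2 ≤ n) :
    Amat (n + 1) * (of fun _ l => if l = 0 then 1 else 0) + Bblk (n + 1) = 0 := by
  have hs : ∀ k, ∑ j, Amat (n + 1) k j = if k = 0 then 1 else 0 := by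
    intro k
    by_cases h0 : k = 0
    · subst h0
      rw [Finset.sum_eq_single 0]
      · simp [Amat]
      · intro b _ hb
        have hz : ((0 : Fin (n + 1)) : ℕ) = 0 := rfl
        simp only [Amat, of_apply]
        rw [if_neg hb.symm, if_neg (by omega), if_neg (by omega)]
      · simp
    rw [if_neg h0]
    have hk : (k : ℕ) ≠ 0 := fun h => h0 (Fin.ext h)
    have : ∀ j, Amat (n + 1) k j = (if j = k then 1 else 0) +
        (if j = (if (k : ℕ) < n then ⟨k - 1, by omega⟩ else 0) then -1 else 0) := by
      intro j
      simp only [Amat, of_apply, Fin.ext_iff]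
      split_ifs <;> first | (exfalso; simp only [Fin.val_zero] at *; omega) | norm_num
    rw [Finset.sum_congr rfl (fun j _ => this j), Finset.sum_add_distrib]
    simp
  ext k l
  have e : (l = 0) ↔ (l : ℕ) = 0 := by simp
  have e' : (k = 0) ↔ (k : ℕ) = 0 := by simp
  simp only [Matrix.add_apply, mul_apply, of_apply, ← Finset.sum_mul, hs, Bblk,
    Matrix.zero_apply, e, e']
  split_ifs <;> simp_all

theorem adj_col {m : ℕ} (M : Matrix (Fin m) (Fin m) ℝ) (r c : Fin m) :
    M.adjugate c r = (M.updateCol c (Pi.single r 1)).det := by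
  rw [← transpose_apply M.adjugate, adjugate_transpose, adjugate_apply, updateRow_transpose,
    det_transpose]

theorem stmt9 (N : ℕ) (hN : 3 ≤ N) (i : Fin N) :
    (minor (Lmat N) (Fin.natAdd N i) (Fin.natAdd N i)).det =
      (-1 : ℝ) ^ (i : ℕ) * (minor (Cmat N) i ⟨0, by omega⟩).det := by
  obtain ⟨n, rfl⟩ : ∃ n, N = n + 1 := ⟨N - 1, by omega⟩
  have hn : 2 ≤ n := by omega
  let X : Matrix (Fin (n + 1)) (Fin (n + 1)) ℝ := of fun _ l => if l = 0 then 1 else 0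
  let C' := (Cmat (n + 1)).updateRow i (Pi.single i 1)
  let D' := (-1 : Matrix (Fin (n + 1)) (Fin (n + 1)) ℝ).updateRow i 0
  let E := D' * X + C'
  have hE : ∀ k l, E k l = if k = i then (if l = i then 1 else 0) else
      Cmat (n + 1) k l - (if l = 0 then 1 else 0) := by
    intro k l
    have hD : D' = of fun k j => if k = i then 0 else if k = j then -1 else 0 := by
      ext a b
      simp only [D', updateRow_apply, of_apply, Matrix.neg_apply, Matrix.one_apply, Pi.zero_apply]
      split_ifs <;> simp
    have : (D' * X) k l = if k = i then 0 else - (if l = 0 then 1 else 0) := by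
      simp only [hD, X, mul_apply, of_apply, ← Finset.sum_mul]
      by_cases h : k = i
      · simp [h]
      · by_cases hl : l = 0 <;> simp [h, hl]
    rw [show E k l = (D' * X) k l + C' k l from rfl, this]
    simp only [C', updateRow_apply, Pi.single_apply]
    split_ifs <;> ring
  have hL : (minor (Lmat (n + 1)) (Fin.natAdd (n + 1) i) (Fin.natAdd (n + 1) i)).det = E.det := by
    rw [show (minor (Lmat (n + 1)) (Fin.natAdd (n + 1) i) (Fin.natAdd (n + 1) i)).det = _ from
      minor_eq (n := n + 1 + n) _ _ _, Even.neg_one_pow ⟨_, rfl⟩, one_mul]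
    have h1 : (Lmat (n + 1)).updateRow (Fin.natAdd (n + 1) i) (Pi.single (Fin.natAdd (n + 1) i) 1)
        = (fromBlocks (Amat (n + 1)) (Bblk (n + 1)) D' C').submatrix
          finSumFinEquiv.symm finSumFinEquiv.symm := by
      ext a b
      obtain ⟨a, rfl⟩ := finSumFinEquiv.surjective a
      obtain ⟨b, rfl⟩ := finSumFinEquiv.surjective b
      rw [← finSumFinEquiv_apply_right]
      simp only [updateRow_apply, Lmat, submatrix_apply, Equiv.symm_apply_apply,
        EmbeddingLike.apply_eq_iff_eq, Pi.single_apply]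
      rcases a with a | a <;> rcases b with b | b <;>
        simp [D', C', updateRow_apply, Pi.single_apply]
    have h2 : fromBlocks (Amat (n + 1)) (Bblk (n + 1)) D' C' * fromBlocks 1 X 0 1
        = fromBlocks (Amat (n + 1)) 0 D' E := by
      rw [fromBlocks_multiply]
      simp only [mul_one, mul_zero, add_zero, E]
      rw [show Amat (n + 1) * X + Bblk (n + 1) = 0 from AX_add_B n hn]
    have h3 := congrArg det h2
    rw [det_mul, det_fromBlocks_zero₂₁, det_fromBlocks_zero₁₂, Amat_det] at h3
    simp only [det_one, mul_one, one_mul] at h3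
    rw [← h3]
    refine (adjugate_apply (Lmat (n + 1)) _ _).trans ?_
    rw [h1, det_submatrix_equiv_self]
  have hE2 : E.det = E.adjugate 0 i := by
    rw [adj_col]
    have := det_updateCol_sum E 0 (fun _ => 1)
    rw [one_smul] at this
    rw [← this]
    congr 2
    funext k
    simp only [one_smul, hE, Pi.single_apply]
    by_cases h : k = i
    · simp [h]
    · simp [h, Finset.sum_sub_distrib, Cmat_rowsum n hn k]
  rw [hL, hE2, adjugate_fin_succ_eq_det_submatrix]
  have hz : (minor (Cmat (n + 1)) i ⟨0, by omega⟩).det =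
      ((Cmat (n + 1)).submatrix i.succAbove (0 : Fin (n + 1)).succAbove).det := by
    rw [← dropIdx_eq, ← dropIdx_eq]; rfl
  rw [hz]
  congr 2
  ext a b
  simp [hE, Fin.succAbove_ne]
end

section
/- For every integer N ≥ 3, det(L_N with row 1 and column 1 removed) + Σ_{i=1}^{N} det(L_N with row N+i and column N+i removed) = 2·det C_N; that is, the normalisation factor Z, given by the sum of the principal cofactors of the Laplacian L_N over the state (1,0) and all inner-ring states (i,1), equals twice the determinant of C_N. -/
open Matrix Real Filter

lemma minor_det {n : ℕ} (M : Matrix (Fin n) (Fin n) ℝ) (i : Fin n) :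
    (minor M i i).det = M.adjugate i i := by
  cases n with
  | zero => exact i.elim0
  | succ n =>
    rw [Matrix.adjugate_fin_succ_eq_det_submatrix]
    have h : (dropIdx i : Fin n → Fin (n+1)) = i.succAbove := by
      funext k
      ext
      simp only [dropIdx, Fin.succAbove, Fin.lt_def]
      split_ifs <;> simp_all <;> omega
    have h2 : ((-1 : ℝ)) ^ ((i : ℕ) + (i : ℕ)) = 1 := Even.neg_one_pow ⟨_, rfl⟩
    rw [h2, one_mul]
    change (M.submatrix (dropIdx i) (dropIdx i)).det = _
    rw [← h]

lemma adj_rank_one {ι : Type*} [Fintype ι] [DecidableEq ι] (P : Matrix ι ι ℝ) (a : ι)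
    (hP : P = 1 - Matrix.of (fun _ j => if j = a then (1:ℝ) else 0)) (i j : ι) :
    P.adjugate i j = if j = a then 1 else 0 := by
  have hrow : P a = 0 := by
    funext k
    subst hP
    by_cases h : k = a
    · subst h; simp
    · simp [h, Ne.symm h, Matrix.one_apply]
  rw [Matrix.adjugate_apply]
  split_ifs with hj
  · subst hj
    have hbase : (P.updateRow j (Pi.single j 1)).det = 1 := by
      have : P.updateRow j (Pi.single j 1) =
          1 + Matrix.replicateCol Unit (fun k => if k = j then (0:ℝ) else -1) *
            Matrix.replicateRow Unit (Pi.single j (1:ℝ)) := by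
        ext k l
        subst hP
        by_cases hk : k = j
        · subst hk
          simp [Matrix.mul_apply, Matrix.one_apply, Pi.single_apply, eq_comm]
        · simp [Matrix.mul_apply, hk, Pi.single_apply, sub_eq_add_neg]
          split_ifs <;> simp
      rw [this, Matrix.det_one_add_replicateCol_mul_replicateRow]
      simp
    by_cases hi : i = j
    · subst hi; exact hbase
    · have : P.updateRow j (Pi.single i 1) =
        (P.updateRow j (Pi.single j 1)).updateRow j
          ((P.updateRow j (Pi.single j 1)) j + (1:ℝ) • (P.updateRow j (Pi.single j 1)) i) := by
        ext k l
        subst hP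
        by_cases hk : k = j
        · subst hk
          simp [hi, Matrix.one_apply, Pi.single_apply, eq_comm]
        · simp [hk]
      rw [this, Matrix.det_updateRow_add_smul_self _ (Ne.symm hi), hbase]
  · apply Matrix.det_eq_zero_of_row_eq_zero a
    intro k
    rw [Matrix.updateRow_ne (Ne.symm hj), hrow]; rfl

lemma detA (N : ℕ) : (Amat N).det = 1 := by
  rw [Matrix.det_of_lowerTriangular]
  · simp [Amat]
  · intro i j hij
    have hij' : (i : ℕ) < j := hij
    have : i ≠ j := by rintro rfl; omega
    have hj := j.isLt
    simp only [Amat, Matrix.of_apply, if_neg this]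
    rw [if_neg (by omega), if_neg (by omega)]

lemma A_one (N : ℕ) (hN : 3 ≤ N) (i : Fin N) :
    ∑ j, Amat N i j = if (i : ℕ) = 0 then 1 else 0 := by
  have hi := i.isLt
  by_cases h0 : (i : ℕ) = 0
  · rw [if_pos h0, Finset.sum_eq_single i]
    · simp [Amat]
    · intro j _ hj
      simp only [Amat, Matrix.of_apply, if_neg (Ne.symm hj)]
      rw [if_neg (by omega), if_neg (by omega)]
    · simp
  · rw [if_neg h0]
    let p : Fin N := ⟨if (i : ℕ) + 1 < N then i - 1 else 0, by split_ifs <;> omega⟩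
    have hp : (p : ℕ) = if (i : ℕ) + 1 < N then (i : ℕ) - 1 else 0 := rfl
    have hip : i ≠ p := by
      intro h
      have := congrArg Fin.val h
      rw [hp] at this
      split_ifs at this <;> omega
    have : ∀ j, Amat N i j = (if j = i then 1 else 0) - (if j = p then 1 else 0) := by
      intro j
      by_cases hj : j = i
      · subst hj; simp [Amat, hip]
      · have hj2 : (j : ℕ) ≠ i := fun h => hj (Fin.ext h)
        have hj3 : j = p ↔ ((i : ℕ) = j + 1 ∧ (i : ℕ) + 1 < N) ∨ ((i : ℕ) = N - 1 ∧ (j : ℕ) = 0) := by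
          rw [Fin.ext_iff, hp]
          split_ifs <;> omega
        simp only [Amat, Matrix.of_apply, if_neg (Ne.symm hj), if_neg hj, hj3]
        split_ifs <;> first | (exfalso; omega) | norm_num
    simp [this]

lemma C_one (N : ℕ) (hN : 3 ≤ N) (i : Fin N) : ∑ j, Cmat N i j = 1 := by
  obtain ⟨m, rfl⟩ : ∃ m, N = m + 3 := ⟨N - 3, by omega⟩
  have hc : ∀ k : Fin (m+3), (((k : ℕ) : ZMod (m+3))) = (k : ZMod (m+3)) :=
    fun k => ZMod.natCast_zmod_val (n := m+3) k
  have key : ∀ i : ZMod (m+3), ∑ j : ZMod (m+3), (if i = j then (3:ℝ)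
    else if i - j = 1 ∨ i - j = -1 then -1 else 0) = 1 := by
    intro i
    have h1 : (1 : ZMod (m+3)) ≠ 0 := by
      intro h
      have := (ZMod.natCast_eq_zero_iff 1 (m+3)).1 (by simpa using h)
      have := Nat.le_of_dvd (by norm_num) this
      omega
    have h2 : (1 : ZMod (m+3)) ≠ -1 := by
      intro h
      have := (ZMod.natCast_eq_zero_iff 2 (m+3)).1 (by push_cast; linear_combination h)
      have := Nat.le_of_dvd (by norm_num) this
      omega
    have : ∀ j : ZMod (m+3), (if i = j then (3:ℝ)
        else if i - j = 1 ∨ i - j = -1 then -1 else 0) =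
        (if j = i then 3 else 0) - (if j = i - 1 then 1 else 0) - (if j = i + 1 then 1 else 0) := by
      intro j
      have e1 : i - j = 1 ↔ j = i - 1 := by constructor <;> intro h <;> linear_combination -h
      have e2 : i - j = -1 ↔ j = i + 1 := by constructor <;> intro h <;> linear_combination -h
      simp only [← e1, ← e2]
      by_cases h : j = i
      · subst h; simp [h1, Ne.symm h1]
      · rw [if_neg (Ne.symm h), if_neg h]
        by_cases q1 : i - j = 1
        · simp [q1, h2]
        · by_cases q2 : i - j = -1 <;> simp [q1, q2, Ne.symm h2]
    simp_rw [this, Finset.sum_sub_distrib]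
    simp
    norm_num
  have := key i
  simp only [Cmat, Matrix.of_apply, hc]
  exact this

theorem main_aux (N : ℕ) (hN : 3 ≤ N) (z : Fin N) (hz : (z : ℕ) = 0) :
    (Matrix.fromBlocks (Amat N) (Bblk N) (-1) (Cmat N)).adjugate (Sum.inl z) (Sum.inl z) +
      ∑ i, (Matrix.fromBlocks (Amat N) (Bblk N) (-1) (Cmat N)).adjugate (Sum.inr i) (Sum.inr i)
      = 2 * (Cmat N).det := by
  set G : Matrix (Fin N ⊕ Fin N) (Fin N ⊕ Fin N) ℝ :=
    Matrix.fromBlocks (Amat N) 0 (-1) (Cmat N) with hG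
  have hzi : ∀ i : Fin N, (i : ℕ) = 0 ↔ i = z := fun i => by rw [Fin.ext_iff, hz]
  have hdet : G.det = (Cmat N).det := by
    rw [hG, Matrix.det_fromBlocks_zero₁₂, detA, one_mul]
  have g1 : G *ᵥ (fun _ => 1) = Pi.single (Sum.inl z) 1 := by
    funext k
    rcases k with k | k
    · simp [hG, Matrix.mulVec, dotProduct, A_one N hN, hzi, Pi.single_apply]
    · simp [hG, Matrix.mulVec, dotProduct, C_one N hN, Matrix.one_apply]
  have g2 : G *ᵥ (Sum.elim (fun _ => 0) (fun _ => 1)) = Sum.elim (fun _ => 0) (fun _ => 1) := by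
    funext k
    rcases k with k | k
    · simp [hG, Matrix.mulVec, dotProduct]
    · simp [hG, Matrix.mulVec, dotProduct, C_one N hN]
  have hF : Matrix.fromBlocks (Amat N) (Bblk N) (-1) (Cmat N) =
      G * (1 - Matrix.of (fun _ j => if j = Sum.inr z then (1:ℝ) else 0)) := by
    rw [mul_sub, mul_one]
    ext k l
    have := congrFun g1 k
    simp only [Matrix.mulVec, dotProduct, mul_one] at this
    simp only [Matrix.sub_apply, Matrix.mul_apply, Matrix.of_apply, ← Finset.sum_mul, this]
    rcases k with k | k <;> rcases l with l | l <;>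
      simp [hG, Bblk, hzi, Pi.single_apply]
    by_cases hk : k = z <;> by_cases hl : l = z <;> simp [hk, hl]
  have hadj : ∀ k l, (Matrix.fromBlocks (Amat N) (Bblk N) (-1) (Cmat N)).adjugate k l =
      G.adjugate (Sum.inr z) l := by
    intro k l
    rw [hF, Matrix.adjugate_mul_distrib, Matrix.mul_apply]
    simp_rw [adj_rank_one _ (Sum.inr z) rfl]
    simp
  have a : ∀ v, G.adjugate *ᵥ (G *ᵥ v) = G.det • v := by
    intro v
    rw [Matrix.mulVec_mulVec, Matrix.adjugate_mul, Matrix.smul_mulVec, Matrix.one_mulVec]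
  have a1 := congrFun (a (fun _ => 1)) (Sum.inr z)
  have a2 := congrFun (a (Sum.elim (fun _ => 0) (fun _ => 1))) (Sum.inr z)
  rw [g1] at a1
  rw [g2] at a2
  simp [Matrix.mulVec, dotProduct, Pi.single_apply] at a1 a2
  simp_rw [hadj]
  rw [← hdet]
  linarith

theorem stmt10 (N : ℕ) (hN : 3 ≤ N) :
    (minor (Lmat N) ⟨0, by omega⟩ ⟨0, by omega⟩).det +
      ∑ i : Fin N, (minor (Lmat N) (Fin.natAdd N i) (Fin.natAdd N i)).det =
    2 * (Cmat N).det := by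
  rw [← main_aux N hN ⟨0, by omega⟩ rfl]
  simp_rw [minor_det, Lmat, Matrix.adjugate_submatrix_equiv_self]
  have h0 : (⟨0, by omega⟩ : Fin (N+N)) = Fin.castAdd N ⟨0, by omega⟩ := rfl
  rw [h0]
  simp only [Matrix.submatrix_apply, finSumFinEquiv_symm_apply_castAdd,
    finSumFinEquiv_symm_apply_natAdd]
end
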